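/- Let n ≥ 2, let α be an odd superfield and u an even superfield, let a₀, …, a_{n−1} be superfields with a_i of parity (−1)^{n−i}, and set T_n ψ := D^n ψ + Σ_{i=0}^{n−1} a_i D^i ψ. Suppose α̂ is an odd superfield and û an even superfield such that T_n(Lψ) = L̂(T_nψ) for every superfield ψ, where Lψ = ∂²ψ + α(Dψ) + uψ and L̂ψ = ∂²ψ + α̂(Dψ) + ûψ. Then α̂ = (−1)^n α − 2∂a_{n−1} and û = u − 2∂a_{n−2} − a_{n−1}((−1)^n α + α̂) + ((1−(−1)^n)/2) Dα. -/

import Mathlib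

noncomputable section
open scoped BigOperators

/-- The exterior algebra `Λ` of `ℝ^N`. -/
abbrev SuperAlg (N : ℕ) : Type := ExteriorAlgebra ℝ (Fin N → ℝ)

/-- The even part `Λ₀` of the exterior algebra. -/
def LambdaEven (N : ℕ) : Submodule ℝ (SuperAlg N) :=
  CliffordAlgebra.evenOdd (0 : QuadraticForm ℝ (Fin N → ℝ)) 0

/-- The odd part `Λ₁` of the exterior algebra. -/
def LambdaOdd (N : ℕ) : Submodule ℝ (SuperAlg N) :=
  CliffordAlgebra.evenOdd (0 : QuadraticForm ℝ (Fin N → ℝ)) 1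

/-- A superfield: a pair `(f₀, f₁)` of maps `ℝ² → Λ`, encoding
`f(x,t,ϑ) = f₀(x,t) + ϑ f₁(x,t)`. -/
@[ext] structure SF (N : ℕ) where
  c0 : ℝ → ℝ → SuperAlg N
  c1 : ℝ → ℝ → SuperAlg N

namespace SF
variable {N : ℕ}

instance : Zero (SF N) := ⟨⟨0, 0⟩⟩
instance : Add (SF N) := ⟨fun f g => ⟨f.c0 + g.c0, f.c1 + g.c1⟩⟩
instance : Neg (SF N) := ⟨fun f => ⟨-f.c0, -f.c1⟩⟩
instance : Sub (SF N) := ⟨fun f g => ⟨f.c0 - g.c0, f.c1 - g.c1⟩⟩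
instance : SMul ℕ (SF N) := ⟨fun n f => ⟨n • f.c0, n • f.c1⟩⟩
instance : SMul ℤ (SF N) := ⟨fun n f => ⟨n • f.c0, n • f.c1⟩⟩
instance : SMul ℝ (SF N) := ⟨fun r f => ⟨r • f.c0, r • f.c1⟩⟩

instance : AddCommGroup (SF N) :=
  Function.Injective.addCommGroup
    (M₂ := (ℝ → ℝ → SuperAlg N) × (ℝ → ℝ → SuperAlg N))
    (fun f => (f.c0, f.c1))
    (fun a b h => by cases a; cases b; simpa using h)
    rfl (fun _ _ => rfl) (fun _ => rfl) (fun _ _ => rfl) (fun _ _ => rfl) (fun _ _ => rfl)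

instance : One (SF N) := ⟨⟨fun _ _ => 1, fun _ _ => 0⟩⟩

/-- The product of superfields: `(fg)₀ = f₀g₀`,
`(fg)₁ = f₁g₀ + σ(f₀)g₁` where `σ` is the grade involution of `Λ`
(this is the bilinear extension of the parity-sign formula for homogeneous factors). -/
instance : Mul (SF N) := ⟨fun f g =>
  ⟨fun x t => f.c0 x t * g.c0 x t,
   fun x t => f.c1 x t * g.c0 x t + CliffordAlgebra.involute (f.c0 x t) * g.c1 x t⟩⟩

/-- An even superfield. -/
def IsEven (f : SF N) : Prop :=
  (∀ x t, f.c0 x t ∈ LambdaEven N) ∧ (∀ x t, f.c1 x t ∈ LambdaOdd N)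

/-- An odd superfield. -/
def IsOdd (f : SF N) : Prop :=
  (∀ x t, f.c0 x t ∈ LambdaOdd N) ∧ (∀ x t, f.c1 x t ∈ LambdaEven N)

/-- A superfield is invertible when `f₀(x,t)` is invertible in `Λ` for all `(x,t)`. -/
def Invertible (f : SF N) : Prop := ∀ x t, IsUnit (f.c0 x t)

/-- The multiplicative inverse of a superfield (junk unless `f` is invertible). -/
def sinv (f : SF N) : SF N :=
  ⟨fun x t => Ring.inverse (f.c0 x t),
   fun x t => -(Ring.inverse (CliffordAlgebra.involute (f.c0 x t)) * f.c1 x t *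
      Ring.inverse (f.c0 x t))⟩

end SF

/-- Derivative of a `Λ`-valued function of one real variable, characterized through all
linear functionals (junk value `0` when not differentiable). -/
def derLam {N : ℕ} (g : ℝ → SuperAlg N) (x : ℝ) : SuperAlg N := by
  classical
  exact if h : ∃ d : SuperAlg N, ∀ l : SuperAlg N →ₗ[ℝ] ℝ,
      HasDerivAt (fun y => l (g y)) (l d) x
    then h.choose else 0

/-- Smoothness of a `Λ`-valued function on `ℝ²`. -/
def SmoothLam {N : ℕ} (g : ℝ → ℝ → SuperAlg N) : Prop :=
  ∀ l : SuperAlg N →ₗ[ℝ] ℝ, ContDiff ℝ (⊤ : ℕ∞) (fun p : ℝ × ℝ => l (g p.1 p.2))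

namespace SF
variable {N : ℕ}

/-- A superfield is smooth when both components are. -/
def Smooth (f : SF N) : Prop := SmoothLam f.c0 ∧ SmoothLam f.c1

/-- `∂f`, the `x`-derivative. -/
def dx (f : SF N) : SF N :=
  ⟨fun x t => derLam (fun y => f.c0 y t) x, fun x t => derLam (fun y => f.c1 y t) x⟩

/-- `∂ₜf`, the `t`-derivative. -/
def dt (f : SF N) : SF N :=
  ⟨fun x t => derLam (fun s => f.c0 x s) t, fun x t => derLam (fun s => f.c1 x s) t⟩

/-- The odd superderivative `D`, with `Df = (f₁, ∂ₓf₀)`, so `D ∘ D = ∂`. -/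
def Dsd (f : SF N) : SF N := ⟨f.c1, fun x t => derLam (fun y => f.c0 y t) x⟩

end SF

/-- `D^n`. -/
def Dpow {N : ℕ} : ℕ → SF N → SF N
  | 0, f => f
  | m + 1, f => (Dpow m f).Dsd

/-- `∂^n`. -/
def Xpow {N : ℕ} : ℕ → SF N → SF N
  | 0, f => f
  | m + 1, f => (Xpow m f).dx

/-- `f` has the parity `(−1)^m`. -/
def parityAt {N : ℕ} (f : SF N) (m : ℕ) : Prop :=
  if m % 2 = 0 then f.IsEven else f.IsOdd

/-- The Manin–Radul supersymmetric KdV system. -/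
def MRSKdV {N : ℕ} (α u : SF N) : Prop :=
  α.dt = (1/4 : ℝ) • (α.dx.dx + (3:ℝ) • (α * α.Dsd) + (6:ℝ) • (α * u)).dx ∧
  u.dt = (1/4 : ℝ) • (u.dx.dx + (3:ℝ) • (u * u) + (3:ℝ) • (α * u.Dsd)).dx

/-- The Lax operator `L = ∂² + αD + u`. -/
def Lop {N : ℕ} (α u ψ : SF N) : SF N := ψ.dx.dx + α * ψ.Dsd + u * ψ

/-- The operator `M = (1/2)α∂D + λ∂ + (1/2)u∂ − (1/4)(∂α)D − (1/4)(∂u)`. -/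
def Mop {N : ℕ} (α u : SF N) (lam : ℝ) (ψ : SF N) : SF N :=
  (1/2 : ℝ) • (α * ψ.Dsd.dx) + lam • ψ.dx + (1/2 : ℝ) • (u * ψ.dx)
    - (1/4 : ℝ) • (α.dx * ψ.Dsd) - (1/4 : ℝ) • (u.dx * ψ)

/-- The linear system `Lψ = λψ`, `∂ₜψ = Mψ` associated with `(α,u)` at `λ`. -/
def LinSys {N : ℕ} (α u : SF N) (lam : ℝ) (ψ : SF N) : Prop :=
  Lop α u ψ = lam • ψ ∧ ψ.dt = Mop α u lam ψ

/-- `δ₀ = −(Dθ₀)θ₀⁻¹`. -/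
def delta0 {N : ℕ} (θ : SF N) : SF N := -(θ.Dsd * θ.sinv)

/-- The Darboux-transformed `α̂ = −α − 2∂δ₀`. -/
def hatAlpha {N : ℕ} (α θ : SF N) : SF N := -α - (2:ℝ) • (delta0 θ).dx

/-- The Darboux-transformed `û = u + Dα + 2δ₀(α + ∂δ₀)`. -/
def hatU {N : ℕ} (α u θ : SF N) : SF N :=
  u + α.Dsd + (2:ℝ) • (delta0 θ * (α + (delta0 θ).dx))

/-- `darbIter θ m j = θ_j[m]`, the `j`-th seed after `m` Darboux steps. -/
def darbIter {N : ℕ} (θ : ℕ → SF N) : ℕ → ℕ → SF N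
  | 0, j => θ j
  | m + 1, j => (darbIter θ m j).Dsd + delta0 (darbIter θ m m) * darbIter θ m j

/-- `Titer θ n ψ = T_n ψ = (D+δ_{n−1})⋯(D+δ₀)ψ`. -/
def Titer {N : ℕ} (θ : ℕ → SF N) : ℕ → SF N → SF N
  | 0, ψ => ψ
  | m + 1, ψ => (Titer θ m ψ).Dsd + delta0 (darbIter θ m m) * Titer θ m ψ

/-- Determinant of a matrix of superfields: Leibniz formula with rows in
ascending order (for matrices of commuting, e.g. even, entries this is the usual
determinant, and when exactly one row is odd it agrees with the Laplace
expansion along that row). -/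
def detSF {N k : ℕ} (M : Matrix (Fin k) (Fin k) (SF N)) : SF N :=
  ∑ σ : Equiv.Perm (Fin k),
    ((Equiv.Perm.sign σ : ℤ)) • (((List.finRange k).map fun i => M i (σ i)).prod)

/-- Entrywise `D`-derivative of a matrix of superfields. -/
def DmatSF {N m n : ℕ} (M : Matrix (Fin m) (Fin n) (SF N)) : Matrix (Fin m) (Fin n) (SF N) :=
  Matrix.of fun i j => (M i j).Dsd

/-- The embedding `Fin (k−1) → Fin k` skipping `j`. -/
def dropIdx {k : ℕ} (j : Fin k) (i : Fin (k - 1)) : Fin k :=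
  ⟨if i.1 < j.1 then i.1 else i.1 + 1, by
    have h1 := i.2; have h2 := j.2; split <;> omega⟩

/-- The minor of `M` obtained by deleting row `j` and column `i`. -/
def minorSF {N k : ℕ} (M : Matrix (Fin k) (Fin k) (SF N)) (j i : Fin k) :
    Matrix (Fin (k-1)) (Fin (k-1)) (SF N) :=
  M.submatrix (dropIdx j) (dropIdx i)

/-- Adjugate matrix (matrix of cofactors, transposed). -/
def adjSF {N k : ℕ} (M : Matrix (Fin k) (Fin k) (SF N)) : Matrix (Fin k) (Fin k) (SF N) :=
  Matrix.of fun i j => ((-1 : ℤ) ^ (i.1 + j.1)) • detSF (minorSF M j i)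

/-- Inverse of a matrix of (even) superfields, via the adjugate
(junk unless `detSF M` is invertible). -/
def invSF {N k : ℕ} (M : Matrix (Fin k) (Fin k) (SF N)) : Matrix (Fin k) (Fin k) (SF N) :=
  Matrix.of fun i j => (detSF M).sinv * adjSF M i j

section EvenWronskian

variable {N : ℕ}

/-- `θ^{(0)} = (θ₀, θ₂, …)`. -/
def evenSeq (θ : ℕ → SF N) : ℕ → SF N := fun j => θ (2 * j)

/-- `θ^{(1)} = (θ₁, θ₃, …)`. -/
def oddSeq (θ : ℕ → SF N) : ℕ → SF N := fun j => θ (2 * j + 1)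

/-- The `k×k` Wronski matrix with rows `v, ∂v, …, ∂^{k−1}v`. -/
def Wmat (N : ℕ) (k : ℕ) (v : ℕ → SF N) : Matrix (Fin k) (Fin k) (SF N) :=
  Matrix.of fun i j => Xpow i.1 (v j.1)

/-- The Wronski matrix with last row replaced by `∂^k v`. -/
def WmatHat (N : ℕ) (k : ℕ) (v : ℕ → SF N) : Matrix (Fin k) (Fin k) (SF N) :=
  Matrix.of fun i j => if i.1 = k - 1 then Xpow k (v j.1) else Xpow i.1 (v j.1)

/-- The Wronski matrix with rows `Dv, D∂v, …, D∂^{k−2}v` and last row `∂^k v`. -/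
def WmatBarD (N : ℕ) (k : ℕ) (v : ℕ → SF N) : Matrix (Fin k) (Fin k) (SF N) :=
  Matrix.of fun i j => if i.1 = k - 1 then Xpow k (v j.1) else (Xpow i.1 (v j.1)).Dsd

/-- `W^{(0)}` (even case, `n = 2k`). -/
def W0E (N k : ℕ) (θ : ℕ → SF N) : Matrix (Fin k) (Fin k) (SF N) := Wmat N k (evenSeq θ)

/-- `W^{(1)}` (even case, `n = 2k`). -/
def W1E (N k : ℕ) (θ : ℕ → SF N) : Matrix (Fin k) (Fin k) (SF N) := Wmat N k (oddSeq θ)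

/-- The Schur complement `W^{(0)} − W^{(1)}(DW^{(1)})⁻¹DW^{(0)}`. -/
def SchurE (N k : ℕ) (θ : ℕ → SF N) : Matrix (Fin k) (Fin k) (SF N) :=
  W0E N k θ - W1E N k θ * invSF (DmatSF (W1E N k θ)) * DmatSF (W0E N k θ)

/-- The Schur complement `DW^{(1)} − (DW^{(0)})(W^{(0)})⁻¹W^{(1)}`. -/
def SchurE2 (N k : ℕ) (θ : ℕ → SF N) : Matrix (Fin k) (Fin k) (SF N) :=
  DmatSF (W1E N k θ) - DmatSF (W0E N k θ) * invSF (W0E N k θ) * W1E N k θ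

/-- `sdet 𝒲` (even case). -/
def sdetE (N k : ℕ) (θ : ℕ → SF N) : SF N :=
  detSF (SchurE N k θ) * (detSF (DmatSF (W1E N k θ))).sinv

/-- The Schur complement of the block matrix `𝒲̂` (even case). -/
def SchurEHat (N k : ℕ) (θ : ℕ → SF N) : Matrix (Fin k) (Fin k) (SF N) :=
  WmatHat N k (evenSeq θ) - WmatHat N k (oddSeq θ) * invSF (DmatSF (W1E N k θ)) * DmatSF (W0E N k θ)

/-- `sdet 𝒲̂` (even case). -/
def sdetEHat (N k : ℕ) (θ : ℕ → SF N) : SF N :=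
  detSF (SchurEHat N k θ) * (detSF (DmatSF (W1E N k θ))).sinv

end EvenWronskian

section OddWronskian

/-- `W^{(0)}`, a `(k+1)×(k+1)` matrix (odd case, `n = 2k+1`). -/
def W0O (N k : ℕ) (θ : ℕ → SF N) : Matrix (Fin (k+1)) (Fin (k+1)) (SF N) :=
  Matrix.of fun i j => Xpow i.1 (θ (2 * j.1))

/-- `W^{(1)}`, a `(k+1)×k` matrix (odd case). -/
def W1O (N k : ℕ) (θ : ℕ → SF N) : Matrix (Fin (k+1)) (Fin k) (SF N) :=
  Matrix.of fun i j => Xpow i.1 (θ (2 * j.1 + 1))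

/-- `W̃^{(0)}`: `W^{(0)}` with its last row removed. -/
def Wtil0 (N k : ℕ) (θ : ℕ → SF N) : Matrix (Fin k) (Fin (k+1)) (SF N) :=
  Matrix.of fun i j => Xpow i.1 (θ (2 * j.1))

/-- `W̃^{(1)}`: `W^{(1)}` with its last row removed. -/
def Wtil1 (N k : ℕ) (θ : ℕ → SF N) : Matrix (Fin k) (Fin k) (SF N) :=
  Matrix.of fun i j => Xpow i.1 (θ (2 * j.1 + 1))

/-- `W̌^{(0)}`: `W^{(0)}` with its second-to-last row removed. -/
def Wchk0 (N k : ℕ) (θ : ℕ → SF N) : Matrix (Fin k) (Fin (k+1)) (SF N) :=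
  Matrix.of fun i j => Xpow (if i.1 = k - 1 then k else i.1) (θ (2 * j.1))

/-- `W̌^{(1)}`: `W^{(1)}` with its second-to-last row removed. -/
def Wchk1 (N k : ℕ) (θ : ℕ → SF N) : Matrix (Fin k) (Fin k) (SF N) :=
  Matrix.of fun i j => Xpow (if i.1 = k - 1 then k else i.1) (θ (2 * j.1 + 1))

/-- `Ŵ^{(0)}`: `W^{(0)}` with last row `∂^k θ^{(0)}` replaced by `D∂^k θ^{(0)}`. -/
def W0OHat (N k : ℕ) (θ : ℕ → SF N) : Matrix (Fin (k+1)) (Fin (k+1)) (SF N) :=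
  Matrix.of fun i j => if i.1 = k then Dpow (2*k+1) (θ (2 * j.1)) else Xpow i.1 (θ (2 * j.1))

/-- `Ŵ^{(1)}`: `W^{(1)}` with last row `∂^k θ^{(1)}` replaced by `D∂^k θ^{(1)}`. -/
def W1OHat (N k : ℕ) (θ : ℕ → SF N) : Matrix (Fin (k+1)) (Fin k) (SF N) :=
  Matrix.of fun i j => if i.1 = k then Dpow (2*k+1) (θ (2 * j.1 + 1)) else Xpow i.1 (θ (2 * j.1 + 1))

/-- The Schur complement `W^{(0)} − W^{(1)}(DW̃^{(1)})⁻¹DW̃^{(0)}`. -/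
def SchurO (N k : ℕ) (θ : ℕ → SF N) : Matrix (Fin (k+1)) (Fin (k+1)) (SF N) :=
  W0O N k θ - W1O N k θ * invSF (DmatSF (Wtil1 N k θ)) * DmatSF (Wtil0 N k θ)

/-- The Schur complement `W^{(0)} − W^{(1)}(DW̌^{(1)})⁻¹DW̌^{(0)}`. -/
def SchurOchk (N k : ℕ) (θ : ℕ → SF N) : Matrix (Fin (k+1)) (Fin (k+1)) (SF N) :=
  W0O N k θ - W1O N k θ * invSF (DmatSF (Wchk1 N k θ)) * DmatSF (Wchk0 N k θ)

/-- The Schur complement `Ŵ^{(0)} − Ŵ^{(1)}(DW̃^{(1)})⁻¹DW̃^{(0)}`. -/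
def SchurOHat (N k : ℕ) (θ : ℕ → SF N) : Matrix (Fin (k+1)) (Fin (k+1)) (SF N) :=
  W0OHat N k θ - W1OHat N k θ * invSF (DmatSF (Wtil1 N k θ)) * DmatSF (Wtil0 N k θ)

/-- `sdet 𝒲` (odd case). -/
def sdetO (N k : ℕ) (θ : ℕ → SF N) : SF N :=
  detSF (SchurO N k θ) * (detSF (DmatSF (Wtil1 N k θ))).sinv

/-- `sdet 𝒲̌` (odd case). -/
def sdetOchk (N k : ℕ) (θ : ℕ → SF N) : SF N :=
  detSF (SchurOchk N k θ) * (detSF (DmatSF (Wchk1 N k θ))).sinv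

/-- The quotient `det(Ŵ^{(0)} − Ŵ^{(1)}(DW̃^{(1)})⁻¹DW̃^{(0)}) / det(W^{(0)} − W^{(1)}(DW̃^{(1)})⁻¹DW̃^{(0)})`. -/
def Qodd (N k : ℕ) (θ : ℕ → SF N) : SF N :=
  detSF (SchurOHat N k θ) * (detSF (SchurO N k θ)).sinv

end OddWronskian

section AbstractOps

variable {R : Type} [Ring R]

/-- Operators of order less than `m`. -/
def OrdLt (D : R →+ R) (m : ℕ) : Submodule R (R → R) :=
  Submodule.span R {P | ∃ j, j < m ∧ P = fun ψ => D^[j] ψ}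

theorem OrdLt_mono (D : R →+ R) {m k : ℕ} (h : m ≤ k) : OrdLt D m ≤ OrdLt D k := by
  apply Submodule.span_mono
  rintro P ⟨j, hj, rfl⟩
  exact ⟨j, by omega, rfl⟩

theorem OrdLt_basic (D : R →+ R) {m j : ℕ} (h : j < m) (c : R) :
    (fun ψ => c * D^[j] ψ) ∈ OrdLt D m :=
  (OrdLt D m).smul_mem c (Submodule.subset_span ⟨j, h, rfl⟩)

theorem OrdLt_D (D : R →+ R) (σ : R →+* R)
    (hD : ∀ f g, D (f * g) = D f * g + σ f * D g) {m : ℕ} {P : R → R}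
    (hP : P ∈ OrdLt D m) : (fun ψ => D (P ψ)) ∈ OrdLt D (m + 1) := by
  induction hP using Submodule.span_induction with
  | mem P h =>
    obtain ⟨j, hj, rfl⟩ := h
    have := OrdLt_basic D (m := m + 1) (j := j + 1) (by omega) 1
    simpa [Function.iterate_succ_apply'] using this
  | zero =>
    have : (fun ψ : R => D ((0 : R → R) ψ)) = 0 := by funext; simp
    rw [this]; exact Submodule.zero_mem _
  | add P Q _ _ hp hq =>
    have : (fun ψ : R => D ((P + Q) ψ)) = (fun ψ => D (P ψ)) + (fun ψ => D (Q ψ)) := by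
      funext; simp
    rw [this]; exact Submodule.add_mem _ hp hq
  | smul c P h hp =>
    have : (fun ψ : R => D ((c • P) ψ)) = D c • P + σ c • (fun ψ => D (P ψ)) := by
      funext; simp [hD]
    rw [this]
    exact Submodule.add_mem _ (Submodule.smul_mem _ _ (OrdLt_mono D (Nat.le_succ m) h))
      (Submodule.smul_mem _ _ hp)

theorem OrdLt_rep (D : R →+ R) {m : ℕ} {P : R → R} (hP : P ∈ OrdLt D m) :
    ∃ c : ℕ → R, ∀ ψ, P ψ = ∑ j ∈ Finset.range m, c j * D^[j] ψ := by
  induction hP using Submodule.span_induction with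
  | mem P h =>
    obtain ⟨j, hj, rfl⟩ := h
    refine ⟨fun i => if i = j then 1 else 0, fun ψ => ?_⟩
    simp [ite_mul, hj]
  | zero => exact ⟨0, by simp⟩
  | add P Q _ _ hp hq =>
    obtain ⟨c, hc⟩ := hp
    obtain ⟨d, hd⟩ := hq
    exact ⟨c + d, fun ψ => by simp [hc, hd, add_mul, Finset.sum_add_distrib]⟩
  | smul b P h hp =>
    obtain ⟨c, hc⟩ := hp
    exact ⟨fun i => b * c i, fun ψ => by simp [hc, Finset.mul_sum, mul_assoc]⟩

theorem ops_unique (D : R →+ R) (p : ℕ → R) (hp0 : p 0 = 1) (hD0 : D (p 0) = 0)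
    (hDp : ∀ k, D (p (k + 1)) = p k) (m : ℕ) (c : ℕ → R)
    (h : ∀ ψ, ∑ j ∈ Finset.range m, c j * D^[j] ψ = 0) : ∀ k, k < m → c k = 0 := by
  have h1 : ∀ j k, D^[j] (p (j + k)) = p k := by
    intro j
    induction j with
    | zero => intro k; simp
    | succ j ih =>
      intro k
      rw [Function.iterate_succ_apply, show j + 1 + k = (j + k) + 1 by omega, hDp, ih]
  have h2 : ∀ j k, k < j → D^[j] (p k) = 0 := by
    intro j k hk
    obtain ⟨d, rfl⟩ : ∃ d, j = d + 1 + k := ⟨j - k - 1, by omega⟩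
    have := h1 k 0
    rw [Function.iterate_add_apply]
    rw [show D^[k] (p k) = p 0 from h1 k 0, Function.iterate_succ_apply, hD0]
    exact iterate_map_zero D d
  intro k
  induction k using Nat.strong_induction_on with
  | _ k ih =>
    intro hk
    have := h (p k)
    rw [Finset.sum_eq_single k] at this
    · rw [show D^[k] (p k) = p 0 from h1 k 0, hp0, mul_one] at this
      exact this
    · intro j hj hjk
      rcases lt_or_gt_of_ne hjk with hlt | hgt
      · rw [ih j hlt (by omega), zero_mul]
      · rw [h2 j k hgt, mul_zero]
    · intro h; simp at h; omega

theorem ops_leading (D : R →+ R) (p : ℕ → R) (hp0 : p 0 = 1) (hD0 : D (p 0) = 0)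
    (hDp : ∀ k, D (p (k + 1)) = p k) (n : ℕ) (A B : R)
    (h : (fun ψ => A * D^[n + 1] ψ + B * D^[n] ψ) ∈ OrdLt D n) : A = 0 ∧ B = 0 := by
  obtain ⟨c, hc⟩ := OrdLt_rep D h
  have := ops_unique D p hp0 hD0 hDp (n + 2)
    (fun j => if j = n + 1 then A else if j = n then B else - c j) (by
      intro ψ
      rw [Finset.sum_range_succ, Finset.sum_range_succ]
      have h3 : ∑ j ∈ Finset.range n,
          (if j = n + 1 then A else if j = n then B else - c j) * D^[j] ψ
          = - ∑ j ∈ Finset.range n, c j * D^[j] ψ := by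
        rw [← Finset.sum_neg_distrib]
        apply Finset.sum_congr rfl
        intro j hj
        simp at hj
        rw [if_neg (by omega), if_neg (by omega), neg_mul]
      rw [h3, ← hc]
      simp)
  have hA := this (n + 1) (by omega)
  have hB := this n (by omega)
  simp at hA hB
  exact ⟨hA, hB⟩

theorem leib_fine (D : R →+ R) (σ : R →+* R)
    (hD : ∀ f g, D (f * g) = D f * g + σ f * D g)
    (hσD : ∀ f, σ (D f) = - D (σ f)) (f : R) (hf : σ f = -f) (k : ℕ) :
    (fun ψ => D^[k] (f * D ψ) - (-1) ^ k * f * D^[k + 1] ψ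
      - (if Even k then 0 else D f) * D^[k] ψ) ∈ OrdLt D k := by
  have hD1 : D 1 = 0 := by simpa using hD 1 1
  have hσm : ∀ (k : ℕ), σ ((-1) ^ k) = (-1) ^ k := by simp
  induction k with
  | zero =>
    have : (fun ψ => D^[0] (f * D ψ) - (-1) ^ 0 * f * D^[0 + 1] ψ
      - (if Even 0 then 0 else D f) * D^[0] ψ) = (0 : R → R) := by
      funext ψ; simp
    rw [this]; exact Submodule.zero_mem _
  | succ k ih =>
    have h1 := OrdLt_D D σ hD ih
    have h2 : (fun ψ => D^[k + 1] (f * D ψ) - (-1) ^ (k + 1) * f * D^[k + 1 + 1] ψ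
      - (if Even (k + 1) then 0 else D f) * D^[k + 1] ψ)
      = (fun ψ => D (D^[k] (f * D ψ) - (-1) ^ k * f * D^[k + 1] ψ
      - (if Even k then 0 else D f) * D^[k] ψ)) +
        (fun ψ => (if Even k then 0 else D (D f)) * D^[k] ψ) := by
      funext ψ
      simp only [Pi.add_apply, map_sub, hD, Function.iterate_succ_apply', map_mul, hσm, hf]
      by_cases hk : Even k
      · have : ¬ Even (k + 1) := by simpa [Nat.even_add_one] using hk
        simp [hk, this, hD1, pow_succ, sub_eq_add_neg]
        try abel
      · have h' : Even (k + 1) := by simpa [Nat.even_add_one] using hk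
        have ho : Odd k := by simpa using hk
        simp [hk, h', hD1, pow_succ, hσD, hf, ho.neg_one_pow]
        try abel
    rw [h2]
    exact Submodule.add_mem _ h1 (OrdLt_basic D (by omega) _)

theorem leib_coarse (D : R →+ R) (σ : R →+* R)
    (hD : ∀ f g, D (f * g) = D f * g + σ f * D g)
    (f : R) (hf : σ f = f) (k : ℕ) :
    (fun ψ => D^[k] (f * ψ) - f * D^[k] ψ) ∈ OrdLt D k := by
  induction k with
  | zero =>
    have : (fun ψ => D^[0] (f * ψ) - f * D^[0] ψ) = (0 : R → R) := by
      funext ψ; simp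
    rw [this]; exact Submodule.zero_mem _
  | succ k ih =>
    have h1 := OrdLt_D D σ hD ih
    have h2 : (fun ψ => D^[k + 1] (f * ψ) - f * D^[k + 1] ψ)
      = (fun ψ => D (D^[k] (f * ψ) - f * D^[k] ψ)) + (fun ψ => D f * D^[k] ψ) := by
      funext ψ
      simp only [Pi.add_apply, map_sub, hD, Function.iterate_succ_apply', hf]
      abel
    rw [h2]
    exact Submodule.add_mem _ h1 (OrdLt_basic D (by omega) _)

theorem OrdLt_sum (D : R →+ R) {m k : ℕ} (P : ℕ → R → R)
    (h : ∀ i, i < k → P i ∈ OrdLt D m) :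
    (fun ψ => ∑ i ∈ Finset.range k, P i ψ) ∈ OrdLt D m := by
  have : (fun ψ => ∑ i ∈ Finset.range k, P i ψ) = ∑ i ∈ Finset.range k, P i := by
    funext ψ; simp
  rw [this]
  exact Submodule.sum_mem _ fun i hi => h i (by simpa using hi)

theorem abstract_main (D : R →+ R) (σ : R →+* R)
    (hD : ∀ f g, D (f * g) = D f * g + σ f * D g)
    (hσD : ∀ f, σ (D f) = - D (σ f)) (hσσ : ∀ f, σ (σ f) = f)
    (p : ℕ → R) (hp0 : p 0 = 1) (hD0 : D (p 0) = 0)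
    (hDp : ∀ k, D (p (k + 1)) = p k)
    (m : ℕ) (α u αh uh : R) (hα : σ α = -α) (hu : σ u = u)
    (a : ℕ → R) (ha : σ (a (m + 1)) = - a (m + 1))
    (hanti : αh * a (m + 1) = - (a (m + 1) * αh))
    (hT : ∀ ψ, D^[m + 2] (D (D (D (D ψ))) + α * D ψ + u * ψ)
        + ∑ i ∈ Finset.range (m + 2), a i * D^[i] (D (D (D (D ψ))) + α * D ψ + u * ψ)
      = D (D (D (D (D^[m + 2] ψ + ∑ i ∈ Finset.range (m + 2), a i * D^[i] ψ))))
        + αh * D (D^[m + 2] ψ + ∑ i ∈ Finset.range (m + 2), a i * D^[i] ψ)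
        + uh * (D^[m + 2] ψ + ∑ i ∈ Finset.range (m + 2), a i * D^[i] ψ)) :
    αh = (-1) ^ (m + 2) * α - (D (D (a (m + 1))) + D (D (a (m + 1)))) ∧
    uh = u - (D (D (a m)) + D (D (a m))) - a (m + 1) * ((-1) ^ (m + 2) * α + αh)
      + (if Even (m + 2) then 0 else D α) := by
  have hDD : ∀ f g, D (D (D (D (f * g)))) = f * D (D (D (D g))) + (D (D f) + D (D f)) * D (D g)
      + D (D (D (D f))) * g := by
    intro f g
    simp only [hD, map_add, hσD, hσσ, map_neg]
    noncomm_ring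
  have hit : ∀ (i : ℕ) (x : R), D (D^[i] x) = D^[i + 1] x := by
    intro i x; rw [Function.iterate_succ_apply']
  have hit' : ∀ (i : ℕ) (x : R), D^[i] (D x) = D^[i + 1] x := by
    intro i x; rw [Function.iterate_succ_apply]
  have hia : ∀ (i : ℕ) (x y : R), D^[i] (x + y) = D^[i] x + D^[i] y := by
    intro i x y; exact iterate_map_add D i x y
  -- pieces of lower order
  have k1 := leib_fine D σ hD hσD α hα (m + 2)
  have k2 := leib_coarse D σ hD u hu (m + 2)
  have k3 := Submodule.smul_mem _ (a (m + 1)) (OrdLt_mono D (Nat.le_succ _)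
    (leib_fine D σ hD hσD α hα (m + 1)))
  have k3' := OrdLt_basic D (m := m + 2) (j := m + 1) (by omega)
    (a (m + 1) * (if Even (m + 1) then 0 else D α))
  have k4 := OrdLt_sum D (m := m + 2) (k := m + 1) (fun i ψ => a i * D^[i] (α * D ψ)) (by
    intro i hi
    have e : (fun ψ => a i * D^[i] (α * D ψ)) =
      a i • ((fun ψ => D^[i] (α * D ψ) - (-1) ^ i * α * D^[i + 1] ψ
      - (if Even i then 0 else D α) * D^[i] ψ) + (fun ψ => (-1) ^ i * α * D^[i + 1] ψ)
      + (fun ψ => (if Even i then 0 else D α) * D^[i] ψ)) := by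
      funext ψ
      simp only [Pi.smul_apply, Pi.add_apply, smul_eq_mul]
      congr 1
      abel
    rw [e]
    exact Submodule.smul_mem _ _ (Submodule.add_mem _ (Submodule.add_mem _
      (OrdLt_mono D (by omega) (leib_fine D σ hD hσD α hα i)) (OrdLt_basic D (by omega) _))
      (OrdLt_basic D (by omega) _)))
  have k5 := OrdLt_sum D (m := m + 2) (k := m + 2) (fun i ψ => a i * D^[i] (u * ψ)) (by
    intro i hi
    have e : (fun ψ => a i * D^[i] (u * ψ)) =
      a i • ((fun ψ => D^[i] (u * ψ) - u * D^[i] ψ) + (fun ψ => u * D^[i] ψ)) := by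
      funext ψ
      simp only [Pi.smul_apply, Pi.add_apply, smul_eq_mul]
      congr 1
      abel
    rw [e]
    exact Submodule.smul_mem _ _ (Submodule.add_mem _
      (OrdLt_mono D (by omega) (leib_coarse D σ hD u hu i)) (OrdLt_basic D (by omega) _)))
  have k6 := OrdLt_sum D (m := m + 2) (k := m)
    (fun i ψ => (D (D (a i)) + D (D (a i))) * D^[i + 2] ψ)
    (fun i hi => OrdLt_basic D (by omega) _)
  have k7 := OrdLt_sum D (m := m + 2) (k := m + 2)
    (fun i ψ => D (D (D (D (a i)))) * D^[i] ψ)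
    (fun i hi => OrdLt_basic D (by omega) _)
  have k8 := Submodule.smul_mem _ αh (OrdLt_sum D (m := m + 2) (k := m + 2)
    (fun i ψ => D (a i) * D^[i] ψ)
    (fun i hi => OrdLt_basic D (by omega) _))
  have k9 := Submodule.smul_mem _ αh (OrdLt_sum D (m := m + 2) (k := m + 1)
    (fun i ψ => σ (a i) * D^[i + 1] ψ)
    (fun i hi => OrdLt_basic D (by omega) _))
  have k10 := Submodule.smul_mem _ uh (OrdLt_sum D (m := m + 2) (k := m + 2)
    (fun i ψ => a i * D^[i] ψ)
    (fun i hi => OrdLt_basic D (by omega) _))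
  have key := ops_leading D p hp0 hD0 hDp (m + 2)
    (αh - ((-1) ^ (m + 2) * α - (D (D (a (m + 1))) + D (D (a (m + 1))))))
    (uh - (u - (D (D (a m)) + D (D (a m))) - a (m + 1) * ((-1) ^ (m + 2) * α + αh)
      + (if Even (m + 2) then 0 else D α))) (by
    have tot := Submodule.sub_mem _
      (Submodule.add_mem _ (Submodule.add_mem _ (Submodule.add_mem _ (Submodule.add_mem _
        (Submodule.add_mem _ k1 k2) k3) k3') k4) k5)
      (Submodule.add_mem _ (Submodule.add_mem _ (Submodule.add_mem _ (Submodule.add_mem _ k6 k7) k8)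
        k9) k10)
    convert tot using 1
    funext ψ
    have h := hT ψ
    have e1 : D (D (D (D (∑ i ∈ Finset.range (m + 2), a i * D^[i] ψ))))
        = ∑ i ∈ Finset.range (m + 2), a i * D^[i + 4] ψ
          + (∑ i ∈ Finset.range m, (D (D (a i)) + D (D (a i))) * D^[i + 2] ψ
            + (D (D (a m)) + D (D (a m))) * D^[m + 2] ψ
            + (D (D (a (m + 1))) + D (D (a (m + 1)))) * D^[m + 2 + 1] ψ)
          + ∑ i ∈ Finset.range (m + 2), D (D (D (D (a i)))) * D^[i] ψ := by
      have : ∑ i ∈ Finset.range m, (D (D (a i)) + D (D (a i))) * D^[i + 2] ψ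
            + (D (D (a m)) + D (D (a m))) * D^[m + 2] ψ
            + (D (D (a (m + 1))) + D (D (a (m + 1)))) * D^[m + 2 + 1] ψ
          = ∑ i ∈ Finset.range (m + 2), (D (D (a i)) + D (D (a i))) * D^[i + 2] ψ := by
        rw [Finset.sum_range_succ, Finset.sum_range_succ]
      rw [this]
      simp only [map_sum, ← Finset.sum_add_distrib]
      apply Finset.sum_congr rfl
      intro i _
      rw [hDD]
      simp only [hit]
    have e2 : D (∑ i ∈ Finset.range (m + 2), a i * D^[i] ψ)
        = ∑ i ∈ Finset.range (m + 2), D (a i) * D^[i] ψ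
          + (∑ i ∈ Finset.range (m + 1), σ (a i) * D^[i + 1] ψ
            - a (m + 1) * D^[m + 2] ψ) := by
      have : ∑ i ∈ Finset.range (m + 1), σ (a i) * D^[i + 1] ψ
            - a (m + 1) * D^[m + 2] ψ
          = ∑ i ∈ Finset.range (m + 2), σ (a i) * D^[i + 1] ψ := by
        rw [Finset.sum_range_succ _ (m + 1), ha, neg_mul, sub_eq_add_neg]
      rw [this]
      simp only [map_sum, ← Finset.sum_add_distrib]
      apply Finset.sum_congr rfl
      intro i _
      rw [hD]
      simp only [hit]
    have e3 : ∑ i ∈ Finset.range (m + 2), a i * D^[i] (D (D (D (D ψ))) + α * D ψ + u * ψ)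
        = ∑ i ∈ Finset.range (m + 2), a i * D^[i + 4] ψ
          + (∑ i ∈ Finset.range (m + 1), a i * D^[i] (α * D ψ)
            + a (m + 1) * D^[m + 1] (α * D ψ))
          + ∑ i ∈ Finset.range (m + 2), a i * D^[i] (u * ψ) := by
      rw [← Finset.sum_range_succ (fun i => a i * D^[i] (α * D ψ))]
      simp only [← Finset.sum_add_distrib]
      apply Finset.sum_congr rfl
      intro i _
      simp only [hia, hit', mul_add]
    have h4 : D (D (D (D (D^[m + 2] ψ)))) = D^[m + 2] (D (D (D (D ψ)))) := by
      simp only [hit, hit']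
    have h5 := congrArg (· * D^[m + 2] ψ) hanti
    simp only [neg_mul] at h5
    have h6 : (-1 : R) ^ (m + 1) = - (-1) ^ (m + 2) := by simp [pow_succ]
    rw [e3, map_add, map_add, map_add, map_add, e1, e2, hia, hia, h4, hit] at h
    simp only [Pi.add_apply, Pi.sub_apply, Pi.smul_apply, smul_eq_mul]
    rw [h6]
    generalize (-1 : R) ^ (m + 2) = s at *
    generalize (if Even (m + 2) then 0 else D α) = q1 at *
    generalize (if Even (m + 1) then 0 else D α) = q2 at *
    generalize ∑ i ∈ Finset.range (m + 2), a i * D^[i + 4] ψ = S1 at *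
    generalize ∑ i ∈ Finset.range m, (D (D (a i)) + D (D (a i))) * D^[i + 2] ψ = S2 at *
    generalize ∑ i ∈ Finset.range (m + 2), D (D (D (D (a i)))) * D^[i] ψ = S3 at *
    generalize ∑ i ∈ Finset.range (m + 2), D (a i) * D^[i] ψ = S4 at *
    generalize ∑ i ∈ Finset.range (m + 1), σ (a i) * D^[i + 1] ψ = S5 at *
    generalize ∑ i ∈ Finset.range (m + 1), a i * D^[i] (α * D ψ) = S6 at *
    generalize ∑ i ∈ Finset.range (m + 2), a i * D^[i] (u * ψ) = S7 at *
    generalize ∑ i ∈ Finset.range (m + 2), a i * D^[i] ψ = S8 at *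
    generalize D^[m + 2] (D (D (D (D ψ)))) = X1 at *
    generalize D^[m + 2] (α * D ψ) = X2 at *
    generalize D^[m + 2] (u * ψ) = X3 at *
    generalize D^[m + 1] (α * D ψ) = X4 at *
    generalize D^[m + 2 + 1] ψ = X5 at *
    change _ = _ + a (m + 1) * (X4 - -s * α * D^[m + 2] ψ - _) + _ + _ + _ - _
    generalize D^[m + 2] ψ = X6 at *
    generalize D^[m + 1] ψ = X7 at *
    generalize D (D (a (m + 1))) = b1 at *
    generalize D (D (a m)) = b2 at *
    generalize a (m + 1) = A at *
    clear tot k1 k2 k3 k3' k4 k5 k6 k7 k8 k9 k10 e1 e2 e3 h4 hT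
    rw [← sub_eq_zero] at h h5 ⊢
    refine Eq.trans ?_ ((congrArg₂ (fun x y => -x + y) h h5).trans (by simp))
    noncomm_ring
    )
  exact ⟨sub_eq_zero.mp key.1, sub_eq_zero.mp key.2⟩

end AbstractOps

section Concrete

variable {N : ℕ}

/-- A basis of the exterior algebra. -/
def slBasis (N : ℕ) : Module.Basis (Finset (Fin N)) ℝ (SuperAlg N) :=
  (Pi.basisFun ℝ (Fin N)).ExteriorAlgebra

/-- `d` is the derivative of `g` at `x`. -/
def HD (g : ℝ → SuperAlg N) (d : SuperAlg N) (x : ℝ) : Prop :=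
  ∀ l : SuperAlg N →ₗ[ℝ] ℝ, HasDerivAt (fun y => l (g y)) (l d) x

theorem HD.derLam_eq {g : ℝ → SuperAlg N} {d : SuperAlg N} {x : ℝ} (h : HD g d x) :
    derLam g x = d := by
  have hex : ∃ d : SuperAlg N, ∀ l : SuperAlg N →ₗ[ℝ] ℝ,
      HasDerivAt (fun y => l (g y)) (l d) x := ⟨d, h⟩
  unfold derLam
  rw [dif_pos hex]
  apply (slBasis N).ext_elem
  intro i
  exact (hex.choose_spec ((slBasis N).coord i)).unique (h ((slBasis N).coord i))

theorem HD.add {f g : ℝ → SuperAlg N} {d e : SuperAlg N} {x : ℝ} (h : HD f d x) (k : HD g e x) :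
    HD (fun y => f y + g y) (d + e) x := by
  intro l
  simpa using (h l).fun_add (k l)

theorem HD.map {f : ℝ → SuperAlg N} {d : SuperAlg N} {x : ℝ} (h : HD f d x)
    (φ : SuperAlg N →ₗ[ℝ] SuperAlg N) : HD (fun y => φ (f y)) (φ d) x :=
  fun l => h (l ∘ₗ φ)

theorem bil_expand (l : SuperAlg N →ₗ[ℝ] ℝ) (a b : SuperAlg N) :
    l (a * b) = ∑ i, ∑ j, (slBasis N).coord i a * (slBasis N).coord j b *
      l (slBasis N i * slBasis N j) := by
  conv_lhs => rw [← (slBasis N).sum_repr a, ← (slBasis N).sum_repr b]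
  simp only [Finset.sum_mul_sum, map_sum, smul_mul_smul_comm, map_smul, smul_eq_mul,
    Module.Basis.coord_apply]

theorem HD.mul {f g : ℝ → SuperAlg N} {d e : SuperAlg N} {x : ℝ} (h : HD f d x) (k : HD g e x) :
    HD (fun y => f y * g y) (d * g x + f x * e) x := by
  intro l
  have e1 : (fun y => l (f y * g y)) = fun y => ∑ i, ∑ j, (slBasis N).coord i (f y) *
      (slBasis N).coord j (g y) * l (slBasis N i * slBasis N j) :=
    funext fun y => bil_expand l _ _
  rw [e1, map_add, bil_expand l d (g x), bil_expand l (f x) e]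
  simp only [← Finset.sum_add_distrib, ← add_mul]
  refine HasDerivAt.fun_sum fun i _ => HasDerivAt.fun_sum fun j _ => ?_
  exact ((h ((slBasis N).coord i)).fun_mul (k ((slBasis N).coord j))).mul_const _

theorem HD.const (c : SuperAlg N) (x : ℝ) : HD (fun _ => c) 0 x := by
  intro l
  simpa using hasDerivAt_const x (l c)

theorem SmoothLam.hd {g : ℝ → ℝ → SuperAlg N} (h : SmoothLam g) (x t : ℝ) :
    HD (fun y => g y t) (derLam (fun y => g y t) x) x := by
  have hd : ∀ l : SuperAlg N →ₗ[ℝ] ℝ, HasDerivAt (fun y => l (g y t))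
      (deriv (fun y => l (g y t)) x) x := by
    intro l
    have h1 : ContDiff ℝ (⊤ : ℕ∞) (fun y : ℝ => l (g y t)) :=
      (h l).comp (contDiff_id.prodMk contDiff_const)
    exact ((h1.differentiable (by simp)) x).hasDerivAt
  have : HD (fun y => g y t)
      (∑ i, deriv (fun y => (slBasis N).coord i (g y t)) x • slBasis N i) x := by
    intro l
    have e : (fun y => l (g y t)) =
        fun y => ∑ i, (slBasis N).coord i (g y t) * l (slBasis N i) := by
      funext y
      conv_lhs => rw [← (slBasis N).sum_repr (g y t)]
      simp only [map_sum, map_smul, smul_eq_mul, Module.Basis.coord_apply]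
    rw [e]
    simp only [map_sum, map_smul, smul_eq_mul]
    exact HasDerivAt.fun_sum fun i _ => (hd ((slBasis N).coord i)).mul_const _
  rw [this.derLam_eq]
  exact this

theorem SmoothLam.der {g : ℝ → ℝ → SuperAlg N} (h : SmoothLam g) :
    SmoothLam (fun x t => derLam (fun y => g y t) x) := by
  intro l
  have e : (fun p : ℝ × ℝ => l (derLam (fun y => g y p.2) p.1)) =
      fun p => fderiv ℝ (fun p : ℝ × ℝ => l (g p.1 p.2)) p (1, 0) := by
    funext p
    have h1 := h.hd p.1 p.2 l
    have h2 : HasFDerivAt (fun p : ℝ × ℝ => l (g p.1 p.2))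
        (fderiv ℝ (fun p : ℝ × ℝ => l (g p.1 p.2)) p) (p.1, p.2) :=
      (((h l).differentiable (by simp)) p).hasFDerivAt
    have h3 : HasDerivAt (fun y : ℝ => (y, p.2)) ((1 : ℝ), (0 : ℝ)) p.1 :=
      (hasDerivAt_id p.1).prodMk (hasDerivAt_const p.1 p.2)
    have h4 := HasFDerivAt.comp_hasDerivAt p.1 h2 h3
    exact h1.unique h4
  rw [e]
  exact ((h l).fderiv_right (m := (⊤ : ℕ∞)) (by simp)).clm_apply contDiff_const

theorem SmoothLam.add {f g : ℝ → ℝ → SuperAlg N} (h : SmoothLam f) (k : SmoothLam g) :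
    SmoothLam (fun x t => f x t + g x t) := by
  intro l
  simpa using (h l).add (k l)

theorem SmoothLam.map {f : ℝ → ℝ → SuperAlg N} (h : SmoothLam f)
    (φ : SuperAlg N →ₗ[ℝ] SuperAlg N) : SmoothLam (fun x t => φ (f x t)) :=
  fun l => h (l ∘ₗ φ)

theorem SmoothLam.mul {f g : ℝ → ℝ → SuperAlg N} (h : SmoothLam f) (k : SmoothLam g) :
    SmoothLam (fun x t => f x t * g x t) := by
  intro l
  have e1 : (fun p : ℝ × ℝ => l (f p.1 p.2 * g p.1 p.2)) = fun p => ∑ i, ∑ j,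
      (slBasis N).coord i (f p.1 p.2) *
      (slBasis N).coord j (g p.1 p.2) * l (slBasis N i * slBasis N j) :=
    funext fun y => bil_expand l _ _
  rw [e1]
  exact ContDiff.sum fun i _ => ContDiff.sum fun j _ =>
    ((h ((slBasis N).coord i)).mul (k ((slBasis N).coord j))).mul contDiff_const

theorem SmoothLam.const (c : SuperAlg N) : SmoothLam (fun _ _ => c) :=
  fun _ => contDiff_const

/-- The grade involution as a linear map. -/
def invL (N : ℕ) : SuperAlg N →ₗ[ℝ] SuperAlg N :=
  (CliffordAlgebra.involute (Q := (0 : QuadraticForm ℝ (Fin N → ℝ)))).toLinearMap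

/-- The ring of superfields. -/
@[reducible] def sfRing (N : ℕ) : Ring (SF N) :=
  { (inferInstance : AddCommGroup (SF N)) with
    mul := fun f g => f * g
    one := 1
    left_distrib := by
      intro a b c
      apply SF.ext <;> funext x t
      · exact mul_add _ _ _
      · change a.c1 x t * (b.c0 x t + c.c0 x t) +
          CliffordAlgebra.involute (a.c0 x t) * (b.c1 x t + c.c1 x t) =
          (a.c1 x t * b.c0 x t + CliffordAlgebra.involute (a.c0 x t) * b.c1 x t) +
          (a.c1 x t * c.c0 x t + CliffordAlgebra.involute (a.c0 x t) * c.c1 x t)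
        noncomm_ring
    right_distrib := by
      intro a b c
      apply SF.ext <;> funext x t
      · exact add_mul _ _ _
      · change (a.c1 x t + b.c1 x t) * c.c0 x t +
          CliffordAlgebra.involute (a.c0 x t + b.c0 x t) * c.c1 x t =
          (a.c1 x t * c.c0 x t + CliffordAlgebra.involute (a.c0 x t) * c.c1 x t) +
          (b.c1 x t * c.c0 x t + CliffordAlgebra.involute (b.c0 x t) * c.c1 x t)
        rw [map_add]
        noncomm_ring
    zero_mul := by
      intro a
      apply SF.ext <;> funext x t
      · exact zero_mul _
      · change 0 * a.c0 x t + CliffordAlgebra.involute 0 * a.c1 x t = 0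
        simp
    mul_zero := by
      intro a
      apply SF.ext <;> funext x t
      · exact mul_zero _
      · change a.c1 x t * 0 + CliffordAlgebra.involute (a.c0 x t) * 0 = 0
        simp
    mul_assoc := by
      intro a b c
      apply SF.ext <;> funext x t
      · exact mul_assoc _ _ _
      · change (a.c1 x t * b.c0 x t + CliffordAlgebra.involute (a.c0 x t) * b.c1 x t) * c.c0 x t +
          CliffordAlgebra.involute (a.c0 x t * b.c0 x t) * c.c1 x t =
          a.c1 x t * (b.c0 x t * c.c0 x t) + CliffordAlgebra.involute (a.c0 x t) *
           (b.c1 x t * c.c0 x t + CliffordAlgebra.involute (b.c0 x t) * c.c1 x t)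
        rw [map_mul]
        noncomm_ring
    one_mul := by
      intro a
      apply SF.ext <;> funext x t
      · exact one_mul _
      · change 0 * a.c0 x t + CliffordAlgebra.involute 1 * a.c1 x t = a.c1 x t
        simp
    mul_one := by
      intro a
      apply SF.ext <;> funext x t
      · exact mul_one _
      · change a.c1 x t * 1 + CliffordAlgebra.involute (a.c0 x t) * 0 = a.c1 x t
        simp }

attribute [local instance] sfRing

/-- The ring of smooth superfields. -/
def smoothSub (N : ℕ) : Subring (SF N) where
  carrier := {f | f.Smooth}
  mul_mem' := fun {a b} ha hb => ⟨ha.1.mul hb.1, (ha.2.mul hb.1).add ((ha.1.map (invL N)).mul hb.2)⟩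
  one_mem' := ⟨SmoothLam.const 1, SmoothLam.const 0⟩
  add_mem' := fun {a b} ha hb => ⟨ha.1.add hb.1, ha.2.add hb.2⟩
  zero_mem' := ⟨SmoothLam.const 0, SmoothLam.const 0⟩
  neg_mem' := fun {a} ha => ⟨ha.1.map (-LinearMap.id), ha.2.map (-LinearMap.id)⟩

theorem Smooth_Dsd {f : SF N} (h : f.Smooth) : f.Dsd.Smooth := ⟨h.2, h.1.der⟩

/-- `D` on smooth superfields. -/
def DS (N : ℕ) : smoothSub N →+ smoothSub N where
  toFun f := ⟨f.1.Dsd, Smooth_Dsd f.2⟩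
  map_zero' := by
    apply Subtype.ext
    apply SF.ext
    · rfl
    · funext x t
      exact (HD.const 0 x).derLam_eq
  map_add' f g := by
    apply Subtype.ext
    apply SF.ext
    · rfl
    · funext x t
      exact ((f.2.1.hd x t).add (g.2.1.hd x t)).derLam_eq

/-- The parity involution on superfields. -/
def sigF (f : SF N) : SF N :=
  ⟨fun x t => CliffordAlgebra.involute (f.c0 x t), fun x t => -CliffordAlgebra.involute (f.c1 x t)⟩

/-- The parity involution on smooth superfields. -/
def sigS (N : ℕ) : smoothSub N →+* smoothSub N where
  toFun f := ⟨sigF f.1, f.2.1.map (invL N), f.2.2.map (-(invL N))⟩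
  map_one' := by
    apply Subtype.ext
    apply SF.ext <;> funext x t
    · exact map_one _
    · change -CliffordAlgebra.involute 0 = 0
      simp
  map_zero' := by
    apply Subtype.ext
    apply SF.ext <;> funext x t
    · exact map_zero _
    · change -CliffordAlgebra.involute 0 = 0
      simp
  map_add' f g := by
    apply Subtype.ext
    apply SF.ext <;> funext x t
    · exact map_add _ _ _
    · change -CliffordAlgebra.involute (f.1.c1 x t + g.1.c1 x t) =
        -CliffordAlgebra.involute (f.1.c1 x t) + -CliffordAlgebra.involute (g.1.c1 x t)
      simp [add_comm]
  map_mul' f g := by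
    apply Subtype.ext
    apply SF.ext <;> funext x t
    · exact map_mul _ _ _
    · change -CliffordAlgebra.involute (f.1.c1 x t * g.1.c0 x t +
        CliffordAlgebra.involute (f.1.c0 x t) * g.1.c1 x t) =
        -CliffordAlgebra.involute (f.1.c1 x t) * CliffordAlgebra.involute (g.1.c0 x t) +
        CliffordAlgebra.involute (CliffordAlgebra.involute (f.1.c0 x t)) *
          -CliffordAlgebra.involute (g.1.c1 x t)
      simp [add_comm]

theorem DS_mul (f g : smoothSub N) : DS N (f * g) = DS N f * g + sigS N f * DS N g := by
  apply Subtype.ext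
  apply SF.ext <;> funext x t
  · rfl
  · refine ((f.2.1.hd x t).mul (g.2.1.hd x t)).derLam_eq.trans ?_
    change derLam (fun y => f.1.c0 y t) x * g.1.c0 x t +
        f.1.c0 x t * derLam (fun y => g.1.c0 y t) x =
      (derLam (fun y => f.1.c0 y t) x * g.1.c0 x t +
        CliffordAlgebra.involute (f.1.c1 x t) * g.1.c1 x t) +
      (-CliffordAlgebra.involute (f.1.c1 x t) * g.1.c1 x t +
        CliffordAlgebra.involute (CliffordAlgebra.involute (f.1.c0 x t)) *
        derLam (fun y => g.1.c0 y t) x)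
    rw [CliffordAlgebra.involute_involute]
    noncomm_ring

theorem sigS_DS (f : smoothSub N) : sigS N (DS N f) = - DS N (sigS N f) := by
  apply Subtype.ext
  apply SF.ext <;> funext x t
  · change CliffordAlgebra.involute (f.1.c1 x t) = - -CliffordAlgebra.involute (f.1.c1 x t)
    simp
  · change -CliffordAlgebra.involute (derLam (fun y => f.1.c0 y t) x) =
      - derLam (fun y => CliffordAlgebra.involute (f.1.c0 y t)) x
    exact congrArg Neg.neg ((f.2.1.hd x t).map (invL N)).derLam_eq.symm

theorem sigS_sigS (f : smoothSub N) : sigS N (sigS N f) = f := by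
  apply Subtype.ext
  apply SF.ext <;> funext x t
  · exact CliffordAlgebra.involute_involute _
  · change -CliffordAlgebra.involute (-CliffordAlgebra.involute (f.1.c1 x t)) = _
    simp

theorem sigS_even (f : smoothSub N) (h : f.1.IsEven) : sigS N f = f := by
  apply Subtype.ext
  apply SF.ext <;> funext x t
  · exact CliffordAlgebra.involute_eq_of_mem_even (h.1 x t)
  · change -CliffordAlgebra.involute (f.1.c1 x t) = _
    rw [CliffordAlgebra.involute_eq_of_mem_odd (h.2 x t), neg_neg]

theorem sigS_odd (f : smoothSub N) (h : f.1.IsOdd) : sigS N f = -f := by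
  apply Subtype.ext
  apply SF.ext <;> funext x t
  · exact CliffordAlgebra.involute_eq_of_mem_odd (h.1 x t)
  · change -CliffordAlgebra.involute (f.1.c1 x t) = -_
    rw [CliffordAlgebra.involute_eq_of_mem_even (h.2 x t)]

theorem mul_gen (x : SuperAlg N) (v : Fin N → ℝ) :
    x * ExteriorAlgebra.ι ℝ v = ExteriorAlgebra.ι ℝ v * CliffordAlgebra.involute x := by
  induction x using ExteriorAlgebra.induction with
  | algebraMap r =>
    rw [AlgHom.commutes]
    exact Algebra.commutes r _
  | ι w =>
    have h1 : CliffordAlgebra.involute (ExteriorAlgebra.ι ℝ w) = -ExteriorAlgebra.ι ℝ w :=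
      CliffordAlgebra.involute_ι w
    rw [h1, mul_neg]
    exact eq_neg_of_add_eq_zero_left (ExteriorAlgebra.ι_add_mul_swap w v)
  | mul a b ha hb => rw [map_mul, mul_assoc, hb, ← mul_assoc, ha, mul_assoc]
  | add a b ha hb => rw [map_add, add_mul, mul_add, ha, hb]

theorem odd_mul {x : SuperAlg N} (hx : x ∈ LambdaOdd N) (y : SuperAlg N) :
    x * y = CliffordAlgebra.involute y * x := by
  have h0 : CliffordAlgebra.involute x = -x := CliffordAlgebra.involute_eq_of_mem_odd hx
  induction y using ExteriorAlgebra.induction with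
  | algebraMap r =>
    rw [AlgHom.commutes]
    exact (Algebra.commutes r _).symm
  | ι w =>
    have h1 : CliffordAlgebra.involute (ExteriorAlgebra.ι ℝ w) = -ExteriorAlgebra.ι ℝ w :=
      CliffordAlgebra.involute_ι w
    rw [h1, mul_gen, h0, mul_neg, neg_mul]
  | mul a b ha hb => rw [map_mul, ← mul_assoc, ha, mul_assoc, hb, ← mul_assoc]
  | add a b ha hb => rw [map_add, add_mul, mul_add, ha, hb]

theorem odd_anti {x y : SuperAlg N} (hx : x ∈ LambdaOdd N) (hy : y ∈ LambdaOdd N) :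
    x * y = -(y * x) := by
  rw [odd_mul hx, CliffordAlgebra.involute_eq_of_mem_odd hy, neg_mul]

theorem odd_even {x y : SuperAlg N} (hx : x ∈ LambdaOdd N) (hy : y ∈ LambdaEven N) :
    x * y = y * x := by
  rw [odd_mul hx, CliffordAlgebra.involute_eq_of_mem_even hy]

theorem SF_odd_anti {f g : SF N} (hf : f.IsOdd) (hg : g.IsOdd) : f * g = -(g * f) := by
  apply SF.ext <;> funext x t
  · exact odd_anti (hf.1 x t) (hg.1 x t)
  · change f.c1 x t * g.c0 x t + CliffordAlgebra.involute (f.c0 x t) * g.c1 x t =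
      -(g.c1 x t * f.c0 x t + CliffordAlgebra.involute (g.c0 x t) * f.c1 x t)
    rw [CliffordAlgebra.involute_eq_of_mem_odd (hf.1 x t),
      CliffordAlgebra.involute_eq_of_mem_odd (hg.1 x t), neg_mul, neg_mul,
      odd_even (hf.1 x t) (hg.2 x t), odd_even (hg.1 x t) (hf.2 x t)]
    abel

/-- Test monomials. -/
def qmon (N k : ℕ) : ℝ → ℝ → SuperAlg N :=
  fun x _ => (x ^ k / (k.factorial : ℝ)) • (1 : SuperAlg N)

theorem qmon_smooth (k : ℕ) : SmoothLam (qmon N k) := by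
  intro l
  have e1 : (fun p : ℝ × ℝ => l (qmon N k p.1 p.2)) =
      fun p => p.1 ^ k / (k.factorial : ℝ) * l 1 :=
    funext fun y => map_smul l _ _
  rw [e1]
  fun_prop

theorem qmon_der (k : ℕ) (x t : ℝ) :
    derLam (fun y => qmon N (k + 1) y t) x = qmon N k x t := by
  apply HD.derLam_eq
  intro l
  have e1 : (fun y => l (qmon N (k + 1) y t)) =
      fun y => y ^ (k + 1) / ((k + 1).factorial : ℝ) * l 1 :=
    funext fun y => map_smul l _ _
  rw [e1, show l (qmon N k x t) = x ^ k / (k.factorial : ℝ) * l 1 from map_smul l _ _]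
  refine HasDerivAt.mul_const ?_ _
  have := (hasDerivAt_pow (k + 1) x).div_const ((k + 1).factorial : ℝ)
  convert this using 1
  rw [Nat.factorial_succ]
  have : (k.factorial : ℝ) ≠ 0 := by positivity
  push_cast
  try simp only [Nat.add_sub_cancel]
  field_simp

/-- Test superfields. -/
def ptest (N k : ℕ) : smoothSub N :=
  if k % 2 = 0 then ⟨⟨qmon N (k / 2), fun _ _ => 0⟩, qmon_smooth _, SmoothLam.const 0⟩
  else ⟨⟨fun _ _ => 0, qmon N (k / 2)⟩, SmoothLam.const 0, qmon_smooth _⟩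

theorem ptest_zero : ptest N 0 = 1 := by
  apply Subtype.ext
  apply SF.ext <;> funext x t
  · change ((x ^ 0 / ((Nat.factorial 0 : ℕ) : ℝ)) • (1 : SuperAlg N)) = 1
    simp
  · rfl

theorem DS_one : DS N 1 = 0 := by
  simpa using DS_mul (1 : smoothSub N) 1

theorem DS_ptest (k : ℕ) : DS N (ptest N (k + 1)) = ptest N k := by
  by_cases h : k % 2 = 0
  · have h1 : ¬ (k + 1) % 2 = 0 := by omega
    have h2 : (k + 1) / 2 = k / 2 := by omega
    rw [ptest, ptest, if_pos h, if_neg h1]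
    apply Subtype.ext
    apply SF.ext <;> funext x t
    · change qmon N ((k + 1) / 2) x t = qmon N (k / 2) x t
      rw [h2]
    · exact (HD.const 0 x).derLam_eq
  · have h1 : (k + 1) % 2 = 0 := by omega
    have h2 : (k + 1) / 2 = k / 2 + 1 := by omega
    rw [ptest, ptest, if_neg h, if_pos h1]
    apply Subtype.ext
    apply SF.ext <;> funext x t
    · rfl
    · change derLam (fun y => qmon N ((k + 1) / 2) y t) x = qmon N (k / 2) x t
      rw [h2]
      exact qmon_der _ x t

theorem Dpow_eq (k : ℕ) (f : smoothSub N) : Dpow k f.1 = ((DS N)^[k] f).1 := by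
  induction k with
  | zero => rfl
  | succ k ih => rw [Function.iterate_succ_apply']; exact congrArg SF.Dsd ih

theorem one_smul_SF (f : SF N) : (1 : ℝ) • f = f := by
  apply SF.ext
  · exact one_smul ℝ f.c0
  · exact one_smul ℝ f.c1

theorem zero_smul_SF (f : SF N) : (0 : ℝ) • f = 0 := by
  apply SF.ext
  · exact zero_smul ℝ f.c0
  · exact zero_smul ℝ f.c1

theorem neg_one_smul_SF (f : SF N) : (-1 : ℝ) • f = -f := by
  apply SF.ext
  · exact neg_one_smul ℝ f.c0
  · exact neg_one_smul ℝ f.c1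

theorem two_smul_SF (f : SF N) : (2 : ℝ) • f = f + f := by
  apply SF.ext
  · exact two_smul ℝ f.c0
  · exact two_smul ℝ f.c1

theorem sign_smul_SF (k : ℕ) (f : SF N) : ((-1 : ℝ) ^ k) • f = (-1) ^ k * f := by
  rcases Nat.even_or_odd k with h | h
  · rw [h.neg_one_pow, h.neg_one_pow, one_smul_SF, one_mul]
  · rw [h.neg_one_pow, h.neg_one_pow, neg_one_smul_SF, neg_one_mul]

theorem half_smul_SF (k : ℕ) (f : SF N) :
    ((1 - (-1 : ℝ) ^ k) / 2) • f = if Even k then 0 else f := by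
  rcases Nat.even_or_odd k with h | h
  · rw [h.neg_one_pow, if_pos h, sub_self, zero_div, zero_smul_SF]
  · rw [h.neg_one_pow, if_neg (Nat.not_even_iff_odd.mpr h)]
    norm_num
    exact one_smul_SF f

theorem conc_main (m : ℕ)
    (α u αh uh : SF N)
    (hαo : α.IsOdd) (hue : u.IsEven) (hαho : αh.IsOdd)
    (hαs : α.Smooth) (hus : u.Smooth) (hαhs : αh.Smooth) (huhs : uh.Smooth)
    (a : Fin (m + 2) → SF N) (hap : ∀ i : Fin (m + 2), parityAt (a i) (m + 2 + i.1))
    (has : ∀ i : Fin (m + 2), (a i).Smooth)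
    (hT : ∀ ψ : SF N, ψ.Smooth →
      Dpow (m + 2) (Lop α u ψ) + ∑ i : Fin (m + 2), a i * Dpow i.1 (Lop α u ψ)
        = Lop αh uh (Dpow (m + 2) ψ + ∑ i : Fin (m + 2), a i * Dpow i.1 ψ)) :
    αh = ((-1 : ℝ) ^ (m + 2)) • α - (2:ℝ) • (a ⟨m + 1, by omega⟩).dx ∧
    uh = u - (2:ℝ) • (a ⟨m, by omega⟩).dx
        - a ⟨m + 1, by omega⟩ * (((-1 : ℝ) ^ (m + 2)) • α + αh)
        + ((1 - (-1 : ℝ) ^ (m + 2)) / 2) • α.Dsd := by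
  rw [sign_smul_SF, two_smul_SF, two_smul_SF, half_smul_SF]
  let b : ℕ → smoothSub N := fun i => if h : i < m + 2 then ⟨a ⟨i, h⟩, has _⟩ else 0
  have hb : ∀ i (h : i < m + 2), b i = ⟨a ⟨i, h⟩, has _⟩ := fun i h => dif_pos h
  have hodd : (a ⟨m + 1, by omega⟩).IsOdd := by
    have := hap ⟨m + 1, by omega⟩
    rw [parityAt, if_neg (by simp; omega)] at this
    exact this
  have hsum : ∀ c : ℕ → smoothSub N,
      ((∑ i ∈ Finset.range (m + 2), b i * c i : smoothSub N) : SF N)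
        = ∑ i : Fin (m + 2), a i * (c i.1 : SF N) := by
    intro c
    rw [← Fin.sum_univ_eq_sum_range (fun i => b i * c i), AddSubmonoidClass.coe_finsetSum]
    apply Finset.sum_congr rfl
    intro i _
    rw [hb i.1 i.2]
    rfl
  have key := abstract_main (DS N) (sigS N) DS_mul sigS_DS sigS_sigS (ptest N) ptest_zero
    (by rw [ptest_zero]; exact DS_one) DS_ptest m ⟨α, hαs⟩ ⟨u, hus⟩ ⟨αh, hαhs⟩ ⟨uh, huhs⟩
    (sigS_odd _ hαo) (sigS_even _ hue) b
    (by rw [hb (m + 1) (by omega)]; exact sigS_odd _ hodd)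
    (by rw [hb (m + 1) (by omega)]; exact Subtype.ext (SF_odd_anti hαho hodd))
    (by
      intro ψ
      have h := hT ψ.1 ψ.2
      apply Subtype.ext
      have e1 : Lop α u ψ.1 = ((DS N (DS N (DS N (DS N ψ))) + ⟨α, hαs⟩ * DS N ψ + ⟨u, hus⟩ * ψ :
        smoothSub N) : SF N) := rfl
      rw [e1] at h
      simp only [Dpow_eq] at h
      rw [← hsum (fun i => (DS N)^[i] (DS N (DS N (DS N (DS N ψ))) + ⟨α, hαs⟩ * DS N ψ
        + ⟨u, hus⟩ * ψ)), ← hsum (fun i => (DS N)^[i] ψ)] at h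
      exact h)
  obtain ⟨k1, k2⟩ := key
  rw [hb (m + 1) (by omega)] at k1 k2
  rw [hb m (by omega)] at k2
  have hpow : (((-1) ^ (m + 2) : smoothSub N) : SF N) = (-1) ^ (m + 2) := by
    simp
  constructor
  · have := congrArg Subtype.val k1
    rw [← hpow]
    exact this
  · have := congrArg Subtype.val k2
    rw [← hpow]
    refine this.trans ?_
    split <;> rfl

end Concrete

/-- the intertwining relation `T_n L = L̂ T_n` forces
`α̂ = (−1)^n α − 2∂a_{n−1}` and
`û = u − 2∂a_{n−2} − a_{n−1}((−1)^n α + α̂) + ((1−(−1)^n)/2)Dα`. -/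
theorem statement_5 {N : ℕ} (hN : 1 ≤ N) (n : ℕ) (hn : 2 ≤ n)
    (α u αh uh : SF N)
    (hαo : α.IsOdd) (hue : u.IsEven) (hαho : αh.IsOdd) (huhe : uh.IsEven)
    (hαs : α.Smooth) (hus : u.Smooth) (hαhs : αh.Smooth) (huhs : uh.Smooth)
    (a : Fin n → SF N) (hap : ∀ i : Fin n, parityAt (a i) (n + i.1))
    (has : ∀ i : Fin n, (a i).Smooth)
    (hT : ∀ ψ : SF N, ψ.Smooth →
      Dpow n (Lop α u ψ) + ∑ i : Fin n, a i * Dpow i.1 (Lop α u ψ)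
        = Lop αh uh (Dpow n ψ + ∑ i : Fin n, a i * Dpow i.1 ψ)) :
    αh = ((-1 : ℝ) ^ n) • α - (2:ℝ) • (a ⟨n-1, by omega⟩).dx ∧
    uh = u - (2:ℝ) • (a ⟨n-2, by omega⟩).dx
        - a ⟨n-1, by omega⟩ * (((-1 : ℝ) ^ n) • α + αh)
        + ((1 - (-1 : ℝ) ^ n) / 2) • α.Dsd := by
  obtain ⟨m, rfl⟩ : ∃ m, n = m + 2 := ⟨n - 2, by omega⟩
  exact conc_main m α u αh uh hαo hue hαho hαs hus hαhs huhs a hap has hT
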